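/- Let F be a field of characteristic 2, let φ be an anisotropic quadratic form over F of dimension 5 and type (1,3) that is not a Pfister neighbour, and let ψ be an anisotropic quadratic form over F of type (2,0) with trivial Arf invariant Δ(ψ)=0, so that ψ is similar to a 2-fold quadratic Pfister form π. Let ψ' be an anisotropic quadratic form over F of dimension 3 with ψ' ≺_w π (a Pfister neighbour of π of dimension 3). Then φ_{F(ψ)} is isotropic if and only if φ_{F(ψ')} is isotropic. -/

import Mathlib

open QuadraticMap MvPolynomial
open scoped TensorProduct

set_option synthInstance.maxHeartbeats 1000000
set_option maxHeartbeats 1000000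


section Defs

variable {K : Type} [CommRing K]

/-- The binary quadratic form `[a,b] : (x,y) ↦ a·x² + x·y + b·y²`. -/
noncomputable def binQF (a b : K) : QuadraticForm K (Fin 2 → K) :=
  (Matrix.of ![![a, 1], ![0, b]]).toQuadraticMap'

/-- The diagonal (totally singular) quadratic form `⟨c₁, …, c_s⟩`. -/
noncomputable def diagQF {s : ℕ} (c : Fin s → K) : QuadraticForm K (Fin s → K) :=
  QuadraticMap.weightedSumSquares K c

/-- The orthogonal sum `[a₁,b₁] ⊥ ⋯ ⊥ [a_r,b_r]` of binary forms. -/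
noncomputable def binsQF {r : ℕ} (a b : Fin r → K) : QuadraticForm K (Fin r → Fin 2 → K) :=
  QuadraticMap.pi fun i => binQF (a i) (b i)

/-- The orthogonal sum of `m` hyperbolic planes `[0,0]`. -/
noncomputable def hypQF (K : Type) [CommRing K] (m : ℕ) :
    QuadraticForm K (Fin m → Fin 2 → K) :=
  binsQF (fun _ => 0) (fun _ => 0)

/-- The `(n+1)`-fold quadratic Pfister form `⟨⟨a₁,…,aₙ⟩⟩_b ⊗ [1,c]`, i.e. the orthogonal
sum over all subsets `S ⊆ {1,…,n}` of `(∏_{i∈S} aᵢ)·[1,c]`. -/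
noncomputable def pfisterQF (n : ℕ) (a : Fin n → K) (c : K) :
    QuadraticForm K (Finset (Fin n) → Fin 2 → K) :=
  QuadraticMap.pi fun S : Finset (Fin n) => (∏ i ∈ S, a i) • binQF 1 c

variable {V W : Type} [AddCommGroup V] [Module K V] [AddCommGroup W] [Module K W]

/-- `φ` has type `(r,s)`: it is isometric to `[a₁,b₁] ⊥ ⋯ ⊥ [a_r,b_r] ⊥ ⟨c₁,…,c_s⟩`. -/
def HasTypeRS (φ : QuadraticForm K V) (r s : ℕ) : Prop :=
  ∃ (a b : Fin r → K) (c : Fin s → K), φ.Equivalent ((binsQF a b).prod (diagQF c))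

/-- `φ` is dominated by `ψ`. -/
def Dominated (φ : QuadraticForm K V) (ψ : QuadraticForm K W) : Prop :=
  ∃ f : V →ₗ[K] W, Function.Injective f ∧ ∀ v, φ v = ψ (f v)

/-- `φ` is weakly dominated by `ψ`: `α·φ` is dominated by `ψ` for some unit `α`. -/
def WeaklyDominated (φ : QuadraticForm K V) (ψ : QuadraticForm K W) : Prop :=
  ∃ α : Kˣ, Dominated ((α : K) • φ) ψ

/-- Witt equivalence of quadratic forms. -/
def WittEquiv (Q₁ : QuadraticForm K V) (Q₂ : QuadraticForm K W) : Prop :=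
  ∃ k l : ℕ, (Q₁.prod (hypQF K k)).Equivalent (Q₂.prod (hypQF K l))

/-- `φ` is a Pfister neighbour: there is a quadratic Pfister form `π` with
`2·dim φ > dim π` and `φ ≺_w π`. -/
def IsPfisterNeighbour (φ : QuadraticForm K V) : Prop :=
  ∃ (n : ℕ) (a : Fin n → Kˣ) (c : K),
    2 * Module.finrank K V > 2 ^ (n + 1) ∧
      WeaklyDominated φ (pfisterQF n (fun i => (a i : K)) c)

/-- The Artin–Schreier set `℘(K) = {t² + t : t ∈ K}`. -/
def ArtinSchreier (K : Type) [CommRing K] : Set K := {x : K | ∃ t : K, x = t ^ 2 + t}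

end Defs

section FunField

variable (F : Type) [Field F]

/-- The coefficient matrix of a quadratic form on `Fin n → F` with respect to the
standard basis: diagonal entries `ψ(eᵢ)`, above-diagonal entries `b_ψ(eᵢ,eⱼ)`. -/
noncomputable def coeffMat {n : ℕ} (ψ : QuadraticForm F (Fin n → F)) :
    Matrix (Fin n) (Fin n) F :=
  Matrix.of fun i j =>
    if i = j then ψ (Pi.single i 1)
    else if i < j then polar ψ (Pi.single i 1) (Pi.single j 1) else 0

/-- The homogeneous degree 2 polynomial `P_ψ` associated to a quadratic form `ψ`. -/
noncomputable def qfPoly {n : ℕ} (ψ : QuadraticForm F (Fin n → F)) :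
    MvPolynomial (Fin n) F :=
  ∑ i : Fin n, ∑ j : Fin n, MvPolynomial.C (coeffMat F ψ i j) * (X i * X j)

/-- The affine coordinate ring `F[x₁,…,xₙ]/(P_ψ)` of the quadric `ψ = 0`. -/
def FunFieldRing {n : ℕ} (ψ : QuadraticForm F (Fin n → F)) : Type :=
  MvPolynomial (Fin n) F ⧸ Ideal.span {qfPoly F ψ}

noncomputable instance {n : ℕ} (ψ : QuadraticForm F (Fin n → F)) :
    CommRing (FunFieldRing F ψ) :=
  inferInstanceAs (CommRing (MvPolynomial (Fin n) F ⧸ Ideal.span {qfPoly F ψ}))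

noncomputable instance {n : ℕ} (ψ : QuadraticForm F (Fin n → F)) :
    Algebra F (FunFieldRing F ψ) :=
  inferInstanceAs (Algebra F (MvPolynomial (Fin n) F ⧸ Ideal.span {qfPoly F ψ}))

/-- The function field `F(ψ)` of the quadric `ψ = 0`. -/
def FunField {n : ℕ} (ψ : QuadraticForm F (Fin n → F)) : Type :=
  FractionRing (FunFieldRing F ψ)

noncomputable instance {n : ℕ} (ψ : QuadraticForm F (Fin n → F)) :
    CommRing (FunField F ψ) :=
  inferInstanceAs (CommRing (FractionRing (FunFieldRing F ψ)))

noncomputable instance {n : ℕ} (ψ : QuadraticForm F (Fin n → F)) :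
    Algebra (FunFieldRing F ψ) (FunField F ψ) :=
  inferInstanceAs (Algebra (FunFieldRing F ψ) (FractionRing (FunFieldRing F ψ)))

noncomputable instance {n : ℕ} (ψ : QuadraticForm F (Fin n → F)) :
    Algebra F (FunField F ψ) :=
  inferInstanceAs (Algebra F (FractionRing (FunFieldRing F ψ)))

/-- The canonical map `F → F(ψ)`. -/
noncomputable def funFieldMap {n : ℕ} (ψ : QuadraticForm F (Fin n → F)) :
    F →+* FunField F ψ :=
  algebraMap F (FunField F ψ)

/-- Scalar extension of a quadratic form on `Fin n → F` along a ring homomorphism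
`f : F → K`. -/
noncomputable def extendQF {K : Type} [CommRing K] (f : F →+* K) {n : ℕ}
    (φ : QuadraticForm F (Fin n → F)) : QuadraticForm K (Fin n → K) :=
  ((coeffMat F φ).map f).toQuadraticMap'

end FunField


section Quat

variable (K : Type) [CommRing K]

/-- Defining relations for the char-2 quaternion algebra `[a,b)`: generators `i,j` with
`i² + i = a`, `j² = b`, `j·i = i·j + j` (i.e. `j·i·j⁻¹ = i + 1`). -/
inductive QuatRel (a b : K) : FreeAlgebra K (Fin 2) → FreeAlgebra K (Fin 2) → Prop
  | i_sq : QuatRel a b (FreeAlgebra.ι K 0 * FreeAlgebra.ι K 0 + FreeAlgebra.ι K 0)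
      (algebraMap K _ a)
  | j_sq : QuatRel a b (FreeAlgebra.ι K 1 * FreeAlgebra.ι K 1) (algebraMap K _ b)
  | swap : QuatRel a b (FreeAlgebra.ι K 1 * FreeAlgebra.ι K 0)
      (FreeAlgebra.ι K 0 * FreeAlgebra.ι K 1 + FreeAlgebra.ι K 1)

/-- The quaternion algebra `[a,b)` over `K` (characteristic two convention). -/
def QuatAlg (a b : K) : Type := RingQuot (QuatRel K a b)

noncomputable instance (a b : K) : Ring (QuatAlg K a b) :=
  inferInstanceAs (Ring (RingQuot (QuatRel K a b)))
noncomputable instance (a b : K) : Algebra K (QuatAlg K a b) :=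
  inferInstanceAs (Algebra K (RingQuot (QuatRel K a b)))

/-- `[a,b)` is split over `K`: isomorphic to the `2×2` matrix algebra. -/
def QuatSplit (a b : K) : Prop :=
  Nonempty (QuatAlg K a b ≃ₐ[K] Matrix (Fin 2) (Fin 2) K)

end Quat

section Sqrt

variable (F : Type) [Field F]

/-- The field `F(√c₁,…,√c_s)` obtained by adjoining square roots of the `cᵢ`
(inside an algebraic closure of `F`). -/
noncomputable def sqrtExt {s : ℕ} (c : Fin s → F) :
    IntermediateField F (AlgebraicClosure F) :=
  IntermediateField.adjoin F
    {y : AlgebraicClosure F | ∃ i, y ^ 2 = algebraMap F (AlgebraicClosure F) (c i)}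

/-- The subfield `F² = {x² : x ∈ F}` of squares of a field of characteristic 2. -/
noncomputable def sqSubfield : Subfield F := Subfield.closure (Set.range fun x : F => x ^ 2)

set_option synthInstance.maxHeartbeats 1000000 in
/-- The norm degree `[F²(cᵢ·cⱼ) : F²]` of a diagonal form `⟨c₁,…,c_s⟩`. -/
noncomputable def normDegree {s : ℕ} (c : Fin s → F) : ℕ :=
  Module.finrank (sqSubfield F)
    (IntermediateField.adjoin (sqSubfield F)
      (Set.range fun p : Fin s × Fin s => c p.1 * c p.2))

end Sqrt

/-- A ring is a division algebra if it is nontrivial and every nonzero element is a unit. -/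
def IsDivisionAlgebra (T : Type) [Ring T] : Prop :=
  (0 : T) ≠ 1 ∧ ∀ x : T, x ≠ 0 → IsUnit x



section ScalarExtension

open scoped Matrix

variable {F : Type} [Field F] {K : Type} [CommRing K] {n m : ℕ}

lemma extendQF_apply (f : F →+* K) (φ : QuadraticForm F (Fin n → F)) (v : Fin n → K) :
    extendQF F f φ v = ∑ i, ∑ j, f (coeffMat F φ i j) * (v i * v j) := by
  simp only [extendQF, Matrix.toQuadraticMap', Matrix.toQuadraticForm',
    LinearMap.BilinMap.toQuadraticMap_apply,
    Matrix.toLinearMap₂'_apply, Matrix.map_apply, smul_eq_mul]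
  exact Finset.sum_congr rfl fun i _ => Finset.sum_congr rfl fun j _ => by ring

lemma extendQF_comp {L : Type} [CommRing L] (f : F →+* K) (g : K →+* L)
    (φ : QuadraticForm F (Fin n → F)) (v : Fin n → K) :
    extendQF F (g.comp f) φ (g ∘ v) = g (extendQF F f φ v) := by
  simp [extendQF_apply, map_sum]

lemma quadraticForm_ext_single {A B : QuadraticForm K (Fin n → K)}
    (h₁ : ∀ i, A (Pi.single i 1) = B (Pi.single i 1))
    (h₂ : ∀ i j, i < j → A (Pi.single i 1 + Pi.single j 1) = B (Pi.single i 1 + Pi.single j 1)) :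
    A = B := by
  have hp : ∀ i j, polar A (Pi.single i 1) (Pi.single j 1)
      = polar B (Pi.single i 1) (Pi.single j 1) := by
    intro i j
    rcases lt_trichotomy i j with h | h | h
    · simp [polar, h₁, h₂ i j h]
    · subst h; simp [polar_self, h₁]
    · rw [polar_comm A, polar_comm B]; simp [polar, h₁, h₂ j i h]
  ext v
  rw [← sum_polar_sub_repr_sq A (Pi.basisFun K (Fin n)) v,
    ← sum_polar_sub_repr_sq B (Pi.basisFun K (Fin n)) v]
  congr 3
  · funext s
    induction s using Sym2.ind with
    | _ i j => simp [hp]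
  · funext i
    simp [h₁]

lemma extendQF_id (φ : QuadraticForm F (Fin n → F)) : extendQF F (RingHom.id F) φ = φ := by
  have key : ∀ v, extendQF F (RingHom.id F) φ v = ∑ i, ∑ j, coeffMat F φ i j * (v i * v j) :=
    fun v => by simp [extendQF_apply]
  have h₁ : ∀ i, extendQF F (RingHom.id F) φ (Pi.single i 1) = φ (Pi.single i 1) := by
    intro i
    rw [key, Finset.sum_eq_single i, Finset.sum_eq_single i] <;>
      simp +contextual [coeffMat, Pi.single_apply]
  refine quadraticForm_ext_single h₁ fun i j hij => ?_
  have h := h₁ i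
  have h' := h₁ j
  rw [key] at h h' ⊢
  have : φ (Pi.single i 1 + Pi.single j 1) = φ (Pi.single i 1) + φ (Pi.single j 1)
      + polar φ (Pi.single i 1) (Pi.single j 1) := by simp [polar]
  rw [this, ← h, ← h']
  have hsplit : ∀ k l : Fin n, coeffMat F φ k l *
      ((Pi.single i 1 + Pi.single j 1 : Fin n → F) k *
        (Pi.single i 1 + Pi.single j 1 : Fin n → F) l)
      = coeffMat F φ k l * ((Pi.single i 1 : Fin n → F) k * (Pi.single i 1 : Fin n → F) l)
      + coeffMat F φ k l * ((Pi.single j 1 : Fin n → F) k * (Pi.single j 1 : Fin n → F) l)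
      + (coeffMat F φ k l * ((Pi.single i 1 : Fin n → F) k * (Pi.single j 1 : Fin n → F) l)
      + coeffMat F φ k l * ((Pi.single j 1 : Fin n → F) k * (Pi.single i 1 : Fin n → F) l)) := by
    intro k l; simp only [Pi.add_apply]; ring
  simp only [hsplit, Finset.sum_add_distrib]
  congr 1
  simp [Pi.single_apply, coeffMat, hij.ne, hij.ne', hij, hij.not_gt]

lemma extendQF_map (f : F →+* K) (φ : QuadraticForm F (Fin n → F)) (v : Fin n → F) :
    extendQF F f φ (f ∘ v) = f (φ v) := by
  simpa [extendQF_id] using extendQF_comp (RingHom.id F) f φ v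

lemma quadraticForm_ext_map (f : F →+* K) {A B : QuadraticForm K (Fin n → K)}
    (h : ∀ v : Fin n → F, A (f ∘ v) = B (f ∘ v)) : A = B := by
  have hs : ∀ i, (f ∘ Pi.single i 1 : Fin n → K) = Pi.single i 1 := by
    intro i; ext k; simp [Pi.single_apply, apply_ite f]
  have ha : ∀ i j, (f ∘ (Pi.single i 1 + Pi.single j 1) : Fin n → K)
      = Pi.single i 1 + Pi.single j 1 := by
    intro i j; rw [← hs i, ← hs j]; ext k; simp
  refine quadraticForm_ext_single (fun i => ?_) fun i j _ => ?_
  · rw [← hs]; exact h _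
  · rw [← ha]; exact h _

lemma extendQF_mulVec (f : F →+* K) {Q : QuadraticForm F (Fin n → F)}
    {Q' : QuadraticForm F (Fin m → F)} {M : Matrix (Fin m) (Fin n) F} {a : F}
    (h : ∀ v, Q' (M *ᵥ v) = a * Q v) (v : Fin n → K) :
    extendQF F f Q' (M.map f *ᵥ v) = f a * extendQF F f Q v := by
  have : (extendQF F f Q').comp (M.map f).mulVecLin = f a • extendQF F f Q := by
    refine quadraticForm_ext_map f fun v => ?_
    have hv : M.map f *ᵥ (f ∘ v) = f ∘ (M *ᵥ v) := by
      ext i; simp [Matrix.mulVec, dotProduct]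
    simp [hv, extendQF_map, h]
  simpa using congrArg (fun A => A v) this

lemma qfPoly_eq (Q : QuadraticForm F (Fin n → F)) :
    qfPoly F Q = extendQF F (C : F →+* MvPolynomial (Fin n) F) Q X := by
  rw [extendQF_apply]; rfl

end ScalarExtension

section Descent

variable {F : Type} [Field F] {n m : ℕ}

lemma exists_isotropic_of_mvPolynomial {K : Type} [CommRing K] (f : F →+* K) {k : ℕ}
    (φ : QuadraticForm F (Fin m → F)) {v : Fin m → MvPolynomial (Fin k) K} (hv : v ≠ 0)
    (h : extendQF F ((C : K →+* MvPolynomial (Fin k) K).comp f) φ v = 0) :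
    ∃ w ≠ 0, extendQF F f φ w = 0 := by
  classical
  let o : MonomialOrder (Fin k) := MonomialOrder.lex
  obtain ⟨i₀, hi₀⟩ := Function.ne_iff.mp hv
  obtain ⟨i, hi, hmax⟩ := Finset.exists_max_image (Finset.univ.filter fun i => v i ≠ 0)
    (fun i => o.toSyn (o.degree (v i))) ⟨i₀, by simpa using hi₀⟩
  have hle : ∀ j, o.toSyn (o.degree (v j)) ≤ o.toSyn (o.degree (v i)) := by
    intro j
    by_cases hj : v j = 0
    · simp [hj]
    · exact hmax j (by simpa using hj)
  refine ⟨fun j => (v j).coeff (o.degree (v i)), fun h0 => ?_, ?_⟩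
  · have := congrFun h0 i
    simp only [Pi.zero_apply] at this
    exact (by simpa using hi : v i ≠ 0) (o.leadingCoeff_eq_zero_iff.mp this)
  · have := congrArg (coeff (o.degree (v i) + o.degree (v i))) h
    simpa [extendQF_apply, coeff_sum, o.coeff_mul_of_add_of_degree_le (hle _) (hle _)] using this

lemma dvd_of_map_dvd_map {K : Type} [Field K] (f : F →+* K) {σ : Type}
    {p g : MvPolynomial σ F} (h : map f p ∣ map f g) : p ∣ g := by
  classical
  let := f.toAlgebra
  obtain ⟨ρ, hρ⟩ := LinearMap.exists_leftInverse_of_injective (Algebra.linearMap F K)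
    (LinearMap.ker_eq_bot.mpr (algebraMap F K).injective)
  have hρf : ∀ a b, ρ (f a * b) = a * ρ b := fun a b =>
    (congrArg ρ (Algebra.smul_def a b).symm).trans (ρ.map_smul a b)
  have hρ1 : ∀ a, ρ (f a) = a := fun a => LinearMap.congr_fun hρ a
  obtain ⟨q, hq⟩ := h
  let q' : MvPolynomial σ F := ∑ d ∈ q.support, monomial d (ρ (q.coeff d))
  have hq' : ∀ d, q'.coeff d = ρ (q.coeff d) := by
    intro d
    simp only [q', coeff_sum, coeff_monomial, Finset.sum_ite_eq', mem_support_iff]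
    split_ifs with hd
    · rfl
    · simp [not_not.mp hd]
  refine ⟨q', ?_⟩
  ext d
  have := congrArg (fun x => ρ (coeff d x)) hq
  simp only [coeff_map, coeff_mul, map_sum, hρf, hρ1] at this
  simpa [coeff_mul, hq'] using this

lemma exists_of_not_anisotropic_funField (Q : QuadraticForm F (Fin n → F))
    (φ : QuadraticForm F (Fin m → F))
    (h : ¬ (extendQF F (funFieldMap F Q) φ).Anisotropic) :
    ∃ v : Fin m → MvPolynomial (Fin n) F, (∃ i, ¬ qfPoly F Q ∣ v i) ∧
      qfPoly F Q ∣ extendQF F C φ v := by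
  simp only [QuadraticMap.Anisotropic, not_forall] at h
  obtain ⟨w, hw, hw0⟩ := h
  obtain ⟨i, hi⟩ := Function.ne_iff.mp hw0
  let R := FunFieldRing F Q
  let π : MvPolynomial (Fin n) F →+* R := Ideal.Quotient.mk (Ideal.span {qfPoly F Q})
  have hπ : Function.Surjective π := Ideal.Quotient.mk_surjective
  have hπ0 : ∀ p, π p = 0 ↔ qfPoly F Q ∣ p := fun p =>
    (Ideal.Quotient.eq_zero_iff_mem).trans Ideal.mem_span_singleton
  have hloc : IsLocalization (nonZeroDivisors R) (FunField F Q) :=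
    inferInstanceAs (IsLocalization (nonZeroDivisors R) (FractionRing R))
  have hinj : Function.Injective (algebraMap R (FunField F Q)) :=
    IsLocalization.injective _ le_rfl
  have hmap : funFieldMap F Q = (algebraMap R (FunField F Q)).comp (π.comp C) :=
    IsScalarTower.algebraMap_eq F R (FractionRing R)
  obtain ⟨b, hb⟩ := IsLocalization.exist_integer_multiples_of_finite (nonZeroDivisors R) w
  choose u hu using hb
  choose v hv using fun j => hπ (u j)
  have huw : algebraMap R (FunField F Q) ∘ u = algebraMap R (FunField F Q) b • w := by
    ext j; simp [hu, Algebra.smul_def]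
  have hvu : π ∘ v = u := funext hv
  refine ⟨v, ⟨i, fun hdvd => hi ?_⟩, ?_⟩
  · have h0 := congrFun huw i
    rw [Function.comp_apply, ← hv, (hπ0 _).mpr hdvd, map_zero, Pi.smul_apply, smul_eq_mul] at h0
    exact (IsLocalization.map_units (FunField F Q) b).mul_right_eq_zero.mp h0.symm
  · rw [← hπ0, ← extendQF_comp, hvu]
    apply hinj
    rw [← extendQF_comp, ← hmap, huw, QuadraticMap.map_smul, hw, smul_zero, map_zero]

lemma irreducible_linearForm {K : Type} [Field K] {ℓ : Fin n → K} (hℓ : ℓ ≠ 0) :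
    Irreducible (∑ i, C (ℓ i) * X i : MvPolynomial (Fin n) K) := by
  classical
  obtain ⟨i, hi⟩ := Function.ne_iff.mp hℓ
  have hc : coeff (Finsupp.single i 1) (∑ i, C (ℓ i) * X i : MvPolynomial (Fin n) K) = ℓ i := by
    simp [coeff_sum, coeff_C_mul, coeff_X, Finsupp.single_left_inj]
  have hne : (∑ i, C (ℓ i) * X i : MvPolynomial (Fin n) K) ≠ 0 := by
    intro h; rw [h] at hc; exact hi hc.symm
  refine irreducible_of_totalDegree_eq_one ?_ fun x hx => ?_
  · exact IsHomogeneous.totalDegree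
      (IsHomogeneous.sum _ _ _ fun j _ => isHomogeneous_C_mul_X _ _) hne
  · have := hx (Finsupp.single i 1)
    rw [hc] at this
    exact isUnit_iff_ne_zero.mpr fun h0 => hi (by simpa [h0] using this)

/-- If `Q` acquires a smooth zero over `K` and the tangent hyperplane there is not contained in
the quadric, then `K(Q)` is rational over `K`, so a form isotropic over `F(Q)` is isotropic
over `K`. -/
lemma not_anisotropic_of_funField {K : Type} [Field K] (f : F →+* K)
    {Q : QuadraticForm F (Fin n → F)} {φ : QuadraticForm F (Fin m → F)} {e r : Fin n → K}
    (he : extendQF F f Q e = 0) (hL : ∃ x, polar (extendQF F f Q) e x ≠ 0)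
    (hr : polar (extendQF F f Q) e r = 0) (hr' : extendQF F f Q r ≠ 0)
    (h : ¬ (extendQF F (funFieldMap F Q) φ).Anisotropic) :
    ¬ (extendQF F f φ).Anisotropic := by
  classical
  obtain ⟨v, ⟨i₀, hi₀⟩, hv⟩ := exists_of_not_anisotropic_funField Q φ h
  have polar_comp : ∀ {A B : Type} [CommRing A] [CommRing B] (a : F →+* A) (g : A →+* B)
      (x y : Fin n → A), polar (extendQF F (g.comp a) Q) (g ∘ x) (g ∘ y)
        = g (polar (extendQF F a Q) x y) := by
    intro A B _ _ a g x y
    have : g ∘ x + g ∘ y = g ∘ (x + y) := by ext; simp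
    simp only [polar, this, extendQF_comp a g, map_sub]
  -- the linear form `b_Q(e, X)` and the quadric over `K`
  set QA := extendQF F ((C : K →+* MvPolynomial (Fin n) K).comp f) Q with hQA
  let P : MvPolynomial (Fin n) K := QA X
  let L : MvPolynomial (Fin n) K := polar QA (C ∘ e) X
  have hP : P = map f (qfPoly F Q) := by
    have h1 : (map f).comp C = (C.comp f : F →+* MvPolynomial (Fin n) K) := by
      ext1 a; exact map_C f a
    have h2 : map f ∘ X = (X : Fin n → MvPolynomial (Fin n) K) := funext fun i => map_X f i
    rw [qfPoly_eq, ← extendQF_comp, h1, h2]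
  have hev : ∀ x : Fin n → K, ((eval x).comp (C.comp f) : F →+* K) = f := fun x => by ext; simp
  have hevX : ∀ x : Fin n → K, (eval x ∘ X : Fin n → K) = x := fun x => by ext; simp
  have hevC : ∀ x y : Fin n → K, (eval x ∘ (C ∘ y) : Fin n → K) = y := fun x y => by ext; simp
  have hPe : ∀ x, eval x P = extendQF F f Q x := fun x => by
    rw [← extendQF_comp, hev, hevX]
  have hLe : ∀ x, eval x L = polar (extendQF F f Q) e x := fun x => by
    rw [← polar_comp, hev, hevX, hevC]
  have hLsum : L = ∑ i, C (polar (extendQF F f Q) e (Pi.single i 1)) * X i := by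
    have hX : (X : Fin n → MvPolynomial (Fin n) K) =
        ∑ i, (X i : MvPolynomial (Fin n) K) • (C ∘ Pi.single i (1 : K)) := by
      ext1 j
      simp [Pi.single_apply, apply_ite C]
    have h : QA.polarBilin (C ∘ e) X = QA.polarBilin (C ∘ e)
        (∑ i, (X i : MvPolynomial (Fin n) K) • (C ∘ Pi.single i (1 : K))) := congrArg _ hX
    change QA.polarBilin (C ∘ e) X = _
    rw [h, map_sum]
    refine Finset.sum_congr rfl fun i _ => ?_
    rw [map_smul, polarBilin_apply_apply, polar_comp, smul_eq_mul, mul_comm]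
  have hLp : Irreducible L := by
    rw [hLsum]
    refine irreducible_linearForm fun h0 => ?_
    obtain ⟨x, hx⟩ := hL
    apply hx
    rw [← hLe, hLsum]
    have h1 : ∀ i, polar (extendQF F f Q) e (Pi.single i 1) = 0 := fun i => congrFun h0 i
    simp [h1]
  have hLP : ¬ L ∣ P := fun ⟨q, hq⟩ => hr' (by rw [← hPe, hq, map_mul, hLe, hr, zero_mul])
  -- the parametrisation of the cone over the quadric by reflections
  let R := MvPolynomial (Fin (n + 1)) K
  let c : F →+* R := C.comp f
  let t : Fin n → R := fun i => X i.succ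
  let QR := extendQF F c Q
  let M : R := polar QR (C ∘ e) t
  let Y : Fin n → R := (X 0 : R) • (QR t • (C ∘ e) + (-M) • t)
  have hY : QR Y = 0 := by
    have h1 : QR (C ∘ e) = 0 := by simp only [QR, c]; rw [extendQF_comp, he, map_zero]
    have h2 : QR (QR t • (C ∘ e) + (-M) • t) = 0 := by
      rw [QuadraticMap.map_add QR, QuadraticMap.map_smul, QuadraticMap.map_smul, h1,
        polar_smul_left, polar_smul_right]
      simp only [smul_eq_mul]
      change _ + _ + QR t * (-M * M) = 0
      ring
    rw [QuadraticMap.map_smul, h2, smul_zero]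
  let Θ : MvPolynomial (Fin n) F →+* R := eval₂Hom c Y
  have hΘC : Θ.comp C = c := by ext; simp [Θ]
  have hΘX : Θ ∘ X = Y := by ext1; simp [Θ]
  have hΘP : Θ (qfPoly F Q) = 0 := by rw [qfPoly_eq, ← extendQF_comp, hΘC, hΘX]; exact hY
  have hΘ : ∀ g, Θ g = 0 → qfPoly F Q ∣ g := by
    intro g hg
    let B := MvPolynomial (Fin n) K ⧸ Ideal.span {P}
    let π : MvPolynomial (Fin n) K →+* B := Ideal.Quotient.mk (Ideal.span {P})
    let S := Localization.Away (π L)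
    let ι : MvPolynomial (Fin n) K →+* S := (algebraMap B S).comp π
    have hιP : ι P = 0 := by
      have : π P = 0 := Ideal.Quotient.eq_zero_iff_mem.mpr (Ideal.mem_span_singleton_self P)
      simp [ι, this]
    let E : R →+* S := eval₂Hom (ι.comp C)
      (Fin.cons (- IsLocalization.Away.invSelf (π L)) (ι ∘ X))
    have hEC : E.comp C = ι.comp C := by
      ext1 a; exact eval₂Hom_C _ _ a
    have hEt : E ∘ t = ι ∘ X := by
      ext1 i; exact eval₂Hom_X' _ _ i.succ
    have hEc : E.comp c = ι.comp (C.comp f) :=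
      RingHom.ext fun a => RingHom.congr_fun hEC (f a)
    have hEe : E ∘ (C ∘ e) = ι ∘ (C ∘ e) := by
      funext i; exact RingHom.congr_fun hEC (e i)
    have hEQ : E (QR t) = 0 := by
      rw [← extendQF_comp, hEt, hEc, extendQF_comp]; exact hιP
    have hEM : E M = ι L := by
      rw [← polar_comp, hEt, hEc, hEe, polar_comp]
    have hinv : ι L * IsLocalization.Away.invSelf (π L) = 1 :=
      IsLocalization.Away.mul_invSelf (π L)
    have hcomp : E.comp Θ = ι.comp (map f) := by
      refine ringHom_ext (fun a => ?_) fun i => ?_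
      · simpa [Θ] using RingHom.congr_fun hEc a
      · have h0 : E (X 0) = - IsLocalization.Away.invSelf (π L) :=
          eval₂Hom_X' _ _ 0
        have h1 : E (t i) = ι (X i) := congrFun hEt i
        have h2 : Θ (X i) = Y i := congrFun hΘX i
        rw [RingHom.comp_apply, h2, RingHom.comp_apply, map_X]
        simp only [Y, Pi.smul_apply, Pi.add_apply, smul_eq_mul, map_mul, map_add, map_neg, h0, h1,
          hEQ, hEM]
        linear_combination ι (X i) * hinv
    have h0 : algebraMap B S (π (map f g)) = 0 := by
      have := RingHom.congr_fun hcomp g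
      rw [RingHom.comp_apply, hg, map_zero] at this
      exact this.symm
    obtain ⟨⟨_, N, rfl⟩, hN⟩ :=
      (IsLocalization.map_eq_zero_iff (Submonoid.powers (π L)) S _).mp h0
    have hdvd : P ∣ L ^ N * map f g := by
      rw [← Ideal.mem_span_singleton, ← Ideal.Quotient.eq_zero_iff_mem]
      simpa [π] using hN
    have hrel : IsRelPrime P (L ^ N) :=
      ((hLp.isRelPrime_iff_not_dvd.mpr hLP).symm).pow_right
    have := hrel.dvd_of_dvd_mul_left hdvd
    rw [hP] at this
    exact dvd_of_map_dvd_map f this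
  obtain ⟨w, hw, hw0⟩ := exists_isotropic_of_mvPolynomial f φ (v := Θ ∘ v)
    (fun h0 => hi₀ (hΘ _ (congrFun h0 i₀))) (by
      obtain ⟨q, hq⟩ := hv
      change extendQF F c φ (Θ ∘ v) = 0
      rw [← hΘC, extendQF_comp, hq, map_mul, hΘP, zero_mul])
  exact fun ha => hw (ha w hw0)

end Descent

section FunctionField

variable {F : Type} [Field F] {n : ℕ}

lemma eval_qfPoly (Q : QuadraticForm F (Fin n → F)) (v : Fin n → F) :
    eval v (qfPoly F Q) = Q v := by
  have h1 : ((eval v).comp C : F →+* F) = RingHom.id F := by ext a; simp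
  have h2 : (eval v ∘ X : Fin n → F) = v := by ext i; simp
  rw [qfPoly_eq, ← extendQF_comp, h1, h2, extendQF_id]

lemma isHomogeneous_qfPoly (Q : QuadraticForm F (Fin n → F)) : (qfPoly F Q).IsHomogeneous 2 :=
  IsHomogeneous.sum _ _ _ fun i _ => IsHomogeneous.sum _ _ _ fun j _ =>
    ((isHomogeneous_X F i).mul (isHomogeneous_X F j)).C_mul _

lemma exists_eval_eq_zero_of_isHomogeneous_one (hn : 2 ≤ n) {A : MvPolynomial (Fin n) F}
    (hA : A.IsHomogeneous 1) : ∃ v ≠ 0, eval v A = 0 := by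
  classical
  have hsum : A = ∑ i, C (coeff (Finsupp.single i 1) A) * X i := by
    ext d
    by_cases hd : ∃ i, Finsupp.single i 1 = d
    · obtain ⟨i, rfl⟩ := hd
      simp [coeff_sum, coeff_C_mul, coeff_X, Finsupp.single_left_inj]
    · push Not at hd
      have h0 : coeff d A = 0 := by
        by_contra h
        have h1 : d.degree = 1 := by
          rw [Finsupp.degree_eq_weight_one]
          exact hA h
        obtain ⟨i, hi⟩ := Finsupp.range_single_one.ge h1
        exact hd i hi
      simp [h0, coeff_sum, coeff_C_mul, coeff_X, hd]
  have hker := LinearMap.ker_ne_bot_of_finrank_lt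
    (f := Fintype.linearCombination F (fun i => coeff (Finsupp.single i 1) A)) (by simp; omega)
  obtain ⟨v, hv, hv0⟩ := Submodule.exists_mem_ne_zero_of_ne_bot hker
  refine ⟨v, hv0, ?_⟩
  rw [hsum]
  simpa [Fintype.linearCombination_apply, mul_comm] using hv

variable {Q : QuadraticForm F (Fin n → F)}

lemma qfPoly_ne_zero (hQ : Q.Anisotropic) (hn : 2 ≤ n) : qfPoly F Q ≠ 0 := fun h => by
  have h1 := eval_qfPoly Q (fun _ => 1)
  rw [h, map_zero] at h1
  exact one_ne_zero (congrFun (hQ _ h1.symm) ⟨0, by omega⟩)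

lemma totalDegree_qfPoly (hQ : Q.Anisotropic) (hn : 2 ≤ n) : (qfPoly F Q).totalDegree = 2 :=
  (isHomogeneous_qfPoly Q).totalDegree (qfPoly_ne_zero hQ hn)

lemma irreducible_qfPoly (hQ : Q.Anisotropic) (hn : 2 ≤ n) : Irreducible (qfPoly F Q) where
  not_isUnit h := by
    have h1 := (MvPolynomial.isUnit_iff_totalDegree_of_isReduced.mp h).2
    have := totalDegree_qfPoly hQ hn
    omega
  isUnit_or_isUnit a b hab := by
    wlog hle : a.totalDegree ≤ b.totalDegree generalizing a b
    · exact (this b a (by rw [hab, mul_comm]) (by lia)).symm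
    have hne := qfPoly_ne_zero hQ hn
    have ha₀ : a ≠ 0 := by rintro rfl; simp [hab] at hne
    have hb₀ : b ≠ 0 := by rintro rfl; simp [hab] at hne
    have hdeg : a.totalDegree + b.totalDegree = 2 := by
      rw [← totalDegree_mul_of_isDomain ha₀ hb₀, ← hab, totalDegree_qfPoly hQ hn]
    rcases Nat.eq_zero_or_pos a.totalDegree with h0 | hpos
    · rw [totalDegree_eq_zero_iff_eq_C.mp h0] at ha₀ ⊢
      exact Or.inl ((isUnit_iff_ne_zero.mpr fun h => ha₀ (by rw [h, C_0])).map C)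
    · exfalso
      have split : ∀ p : MvPolynomial (Fin n) F, p.totalDegree = 1 →
          p = homogeneousComponent 0 p + homogeneousComponent 1 p := fun p hp => by
        conv_lhs => rw [← sum_homogeneousComponent p, hp]
        simp [Finset.sum_range_succ]
      set a₀ := homogeneousComponent 0 a
      set a₁ := homogeneousComponent 1 a with ha₁
      set b₀ := homogeneousComponent 0 b
      set b₁ := homogeneousComponent 1 b
      have hP : qfPoly F Q = a₁ * b₁ := by
        have h1 : qfPoly F Q = a₀ * b₀ + (a₀ * b₁ + a₁ * b₀) + a₁ * b₁ := by
          rw [hab, split a (by omega), split b (by omega)]; ring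
        have hom := fun i (p : MvPolynomial (Fin n) F) => homogeneousComponent_isHomogeneous i p
        have e0 := homogeneousComponent_of_mem (m := 2) ((hom 0 a).mul (hom 0 b))
        have e1 := homogeneousComponent_of_mem (m := 2) ((hom 0 a).mul (hom 1 b))
        have e2 := homogeneousComponent_of_mem (m := 2) ((hom 1 a).mul (hom 0 b))
        have e3 := homogeneousComponent_of_mem (m := 2) ((hom 1 a).mul (hom 1 b))
        have e4 := homogeneousComponent_of_mem (m := 2) (isHomogeneous_qfPoly Q)
        rw [if_pos rfl] at e4
        rw [← e4, h1]
        simp only [map_add, a₀, a₁, b₀, b₁, e0, e1, e2, e3]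
        norm_num
      obtain ⟨v, hv, hv0⟩ := exists_eval_eq_zero_of_isHomogeneous_one hn
        (homogeneousComponent_isHomogeneous 1 a)
      refine hv (hQ v ?_)
      rw [← eval_qfPoly, hP, map_mul, ha₁, hv0, zero_mul]

lemma isDomain_funFieldRing (hQ : Q.Anisotropic) (hn : 2 ≤ n) : IsDomain (FunFieldRing F Q) :=
  (Ideal.Quotient.isDomain_iff_prime _).mpr
    ((Ideal.span_singleton_prime (qfPoly_ne_zero hQ hn)).mpr (irreducible_qfPoly hQ hn).prime)

lemma isField_funField (hQ : Q.Anisotropic) (hn : 2 ≤ n) : IsField (FunField F Q) := by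
  have := isDomain_funFieldRing hQ hn
  exact Field.toIsField (FractionRing (FunFieldRing F Q))

lemma exists_isotropic_funField (hQ : Q.Anisotropic) (hn : 2 ≤ n) :
    ∃ e ≠ 0, extendQF F (funFieldMap F Q) Q e = 0 := by
  let R := FunFieldRing F Q
  let π : MvPolynomial (Fin n) F →+* R := Ideal.Quotient.mk (Ideal.span {qfPoly F Q})
  have hπ0 : ∀ p, π p = 0 ↔ qfPoly F Q ∣ p := fun p =>
    (Ideal.Quotient.eq_zero_iff_mem).trans Ideal.mem_span_singleton
  have hloc : IsLocalization (nonZeroDivisors R) (FunField F Q) :=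
    inferInstanceAs (IsLocalization (nonZeroDivisors R) (FractionRing R))
  have hinj : Function.Injective (algebraMap R (FunField F Q)) :=
    IsLocalization.injective _ le_rfl
  have hmap : funFieldMap F Q = ((algebraMap R (FunField F Q)).comp π).comp C :=
    IsScalarTower.algebraMap_eq F R (FractionRing R)
  refine ⟨(algebraMap R (FunField F Q)).comp π ∘ X, fun h0 => ?_, ?_⟩
  · have h1 : π (X ⟨0, by omega⟩) = 0 := hinj (by rw [map_zero]; exact congrFun h0 _)
    obtain ⟨q, hq⟩ := (hπ0 _).mp h1
    have hq0 : q ≠ 0 := by rintro rfl; simp [X_ne_zero] at hq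
    have := congrArg totalDegree hq
    rw [totalDegree_mul_of_isDomain (qfPoly_ne_zero hQ hn) hq0, totalDegree_X,
      totalDegree_qfPoly hQ hn] at this
    omega
  · rw [hmap, extendQF_comp, ← qfPoly_eq, RingHom.comp_apply, (hπ0 _).mpr dvd_rfl, map_zero]

end FunctionField

section QuatNorm

variable {R : Type} [CommRing R]

/-- The norm form `[1,c] ⊥ d[1,c]` in coordinates on `Fin 4 → R`. -/
noncomputable def quatNorm (c d : R) : QuadraticForm R (Fin 4 → R) :=
  LinearMap.BilinMap.toQuadraticMap
    (Matrix.toLinearMap₂' R !![1, 1, 0, 0; 0, c, 0, 0; 0, 0, d, d; 0, 0, 0, d * c])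

lemma quatNorm_apply (c d : R) (v : Fin 4 → R) : quatNorm c d v =
    v 0 ^ 2 + v 0 * v 1 + c * v 1 ^ 2 + d * (v 2 ^ 2 + v 2 * v 3 + c * v 3 ^ 2) := by
  simp [quatNorm, LinearMap.BilinMap.toQuadraticMap_apply, Matrix.toLinearMap₂'_apply,
    Fin.sum_univ_four]
  ring

lemma polar_quatNorm (c d : R) [CharP R 2] (u v : Fin 4 → R) : polar (quatNorm c d) u v =
    u 0 * v 1 + u 1 * v 0 + d * (u 2 * v 3 + u 3 * v 2) := by
  simp only [polar, quatNorm_apply, Pi.add_apply]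
  linear_combination (u 0 * v 0 + c * u 1 * v 1 + d * (u 2 * v 2 + c * u 3 * v 3)) *
    (CharTwo.two_eq_zero (R := R))

/-- Multiplication in the quaternion algebra with norm form `quatNorm c d`
(Cayley–Dickson doubling of `R[i]`, `i² = i - c`). -/
def quatMul (c d : R) (u v : Fin 4 → R) : Fin 4 → R :=
  ![u 0 * v 0 - c * u 1 * v 1 - d * ((v 2 + v 3) * u 2 + c * v 3 * u 3),
    u 0 * v 1 + u 1 * v 0 + u 1 * v 1 - d * (v 2 * u 3 - v 3 * u 2),
    v 2 * u 0 - c * v 3 * u 1 + u 2 * (v 0 + v 1) + c * u 3 * v 1,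
    v 2 * u 1 + v 3 * u 0 + v 3 * u 1 + u 3 * v 0 - u 2 * v 1]

lemma quatNorm_quatMul (c d : R) (u v : Fin 4 → R) :
    quatNorm c d (quatMul c d u v) = quatNorm c d u * quatNorm c d v := by
  simp [quatNorm_apply, quatMul]
  ring

lemma quatMul_conj_quatMul (c d : R) (u v : Fin 4 → R) :
    quatMul c d ![u 0 + u 1, -u 1, -u 2, -u 3] (quatMul c d u v) = quatNorm c d u • v := by
  ext i
  fin_cases i <;> simp [quatNorm_apply, quatMul] <;> ring

lemma polar_quatNorm_quatMul (c d : R) [CharP R 2] (u v : Fin 4 → R) :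
    polar (quatNorm c d) u (quatMul c d u v) = quatNorm c d u * v 1 := by
  have h2 := CharTwo.two_eq_zero (R := R)
  simp only [polar_quatNorm, quatNorm_apply, quatMul, Matrix.cons_val]
  grind

lemma extendQF_quatNorm {F : Type} [Field F] (f : F →+* R) (c d : F) :
    extendQF F f (quatNorm c d) = quatNorm (f c) (f d) :=
  quadraticForm_ext_map f fun v => by simp [extendQF_map, quatNorm_apply]

lemma eq_zero_of_polar_quatNorm {K : Type} [Field K] [CharP K 2] {c d : K} (hd : d ≠ 0)
    {u : Fin 4 → K} (h : ∀ v, polar (quatNorm c d) u v = 0) : u = 0 := by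
  have h0 := h ![1, 0, 0, 0]
  have h1 := h ![0, 1, 0, 0]
  have h2 := h ![0, 0, 1, 0]
  have h3 := h ![0, 0, 0, 1]
  simp [polar_quatNorm, hd] at h0 h1 h2 h3
  ext i
  fin_cases i <;> simp [h0, h1, h2, h3]

lemma exists_isotropic_apply_one_eq_zero {K : Type} [Field K] {c d : K} (hd : d ≠ 0)
    {e : Fin 4 → K} (he : e ≠ 0) (h : quatNorm c d e = 0) :
    ∃ z ≠ 0, quatNorm c d z = 0 ∧ z 1 = 0 := by
  rw [quatNorm_apply] at h
  by_cases hN : e 2 ^ 2 + e 2 * e 3 + c * e 3 ^ 2 = 0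
  · by_cases hβ : e 2 = 0 ∧ e 3 = 0
    · refine ⟨![0, 0, e 0, e 1], fun h0 => he ?_, ?_, rfl⟩
      · have h2 := congrFun h0 2
        have h3 := congrFun h0 3
        ext i
        fin_cases i
        exacts [h2, h3, hβ.1, hβ.2]
      · simp only [quatNorm_apply, Matrix.cons_val]
        linear_combination d * h - d ^ 2 * hN
    · refine ⟨![0, 0, e 2, e 3], fun h0 => hβ ⟨congrFun h0 2, congrFun h0 3⟩, ?_, rfl⟩
      simp only [quatNorm_apply, Matrix.cons_val]
      linear_combination d * hN
  · refine ⟨![d * (e 2 ^ 2 + e 2 * e 3 + c * e 3 ^ 2), 0,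
      e 2 * (e 0 + e 1) + c * e 3 * e 1, e 3 * e 0 - e 2 * e 1],
      fun h0 => mul_ne_zero hd hN (congrFun h0 0), ?_, rfl⟩
    simp only [quatNorm_apply, Matrix.cons_val]
    linear_combination d * (e 2 ^ 2 + e 2 * e 3 + c * e 3 ^ 2) * h

variable {K : Type} [Field K] [CharP K 2] {c d : K}

lemma exists_isotropic_polar_eq_zero (hd : d ≠ 0) {u e : Fin 4 → K}
    (hu : quatNorm c d u ≠ 0) (he : e ≠ 0) (h : quatNorm c d e = 0) :
    ∃ v ≠ 0, polar (quatNorm c d) u v = 0 ∧ quatNorm c d v = 0 := by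
  obtain ⟨z, hz, hz0, hz1⟩ := exists_isotropic_apply_one_eq_zero hd he h
  refine ⟨quatMul c d u z, fun h0 => hz ?_, ?_, ?_⟩
  · have := quatMul_conj_quatMul c d u z
    rw [h0] at this
    have h1 : quatMul c d ![u 0 + u 1, -u 1, -u 2, -u 3] 0 = 0 := by
      ext i; fin_cases i <;> simp [quatMul]
    exact (smul_eq_zero.mp (this.symm.trans h1)).resolve_left hu
  · rw [polar_quatNorm_quatMul, hz1, mul_zero]
  · rw [quatNorm_quatMul, hz0, mul_zero]

lemma exists_apply_eq_of_polar_eq_zero (hd : d ≠ 0) {u : Fin 4 → K} (hu : u ≠ 0)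
    {J : (Fin 3 → K) →ₗ[K] (Fin 4 → K)} (hJ : Function.Injective J)
    (hJu : ∀ x, polar (quatNorm c d) u (J x) = 0) {w : Fin 4 → K}
    (hw : polar (quatNorm c d) u w = 0) : ∃ x, J x = w := by
  have hne : (quatNorm c d).polarBilin u ≠ 0 := fun h0 =>
    hu (eq_zero_of_polar_quatNorm hd fun v => LinearMap.congr_fun h0 v)
  have hle : LinearMap.range J ≤ LinearMap.ker ((quatNorm c d).polarBilin u) := by
    rintro _ ⟨x, rfl⟩
    exact hJu x
  have hfin : Module.finrank K (LinearMap.ker ((quatNorm c d).polarBilin u)) ≤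
      Module.finrank K (LinearMap.range J) := by
    have h1 := Submodule.finrank_lt (lt_top_iff_ne_top.mpr (mt LinearMap.ker_eq_top.mp hne)).ne
    rw [LinearMap.finrank_range_of_inj hJ]
    simp at h1 ⊢
    omega
  have := Submodule.eq_of_le_of_finrank_le hle hfin
  exact this.ge hw

lemma eq_zero_of_polar_quatNorm_apply (hd : d ≠ 0) {u v : Fin 4 → K} (hu : quatNorm c d u ≠ 0)
    {J : (Fin 3 → K) →ₗ[K] (Fin 4 → K)} (hJ : Function.Injective J)
    (hJu : ∀ x, polar (quatNorm c d) u (J x) = 0)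
    (hJv : ∀ x, polar (quatNorm c d) v (J x) = 0) (hv : quatNorm c d v = 0) : v = 0 := by
  have hu0 : u ≠ 0 := by rintro rfl; simp at hu
  have hmem : (quatNorm c d).polarBilin v ∈
      Submodule.span K (Set.range fun _ : Unit => (quatNorm c d).polarBilin u) := by
    refine mem_span_of_iInf_ker_le_ker fun w hw => ?_
    obtain ⟨x, rfl⟩ := exists_apply_eq_of_polar_eq_zero hd hu0 hJ hJu (by simpa using hw)
    exact hJv x
  rw [Set.range_const, Submodule.mem_span_singleton] at hmem
  obtain ⟨μ, hμ⟩ := hmem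
  have huv : v = μ • u := by
    refine sub_eq_zero.mp (eq_zero_of_polar_quatNorm (c := c) hd fun w => ?_)
    have := LinearMap.congr_fun hμ w
    rw [polar_sub_left, polar_smul_left, sub_eq_zero]
    exact this.symm
  rw [huv, QuadraticMap.map_smul] at hv
  have : μ = 0 := by simpa [hu] using hv
  rw [huv, this, zero_smul]

end QuatNorm

section Transfer

variable {F : Type} [Field F] {n m : ℕ}

lemma quatNorm_equivalent_pfisterQF (c d : F) :
    (quatNorm c d).Equivalent (pfisterQF 1 (fun _ => d) c) := by
  have hu : (Finset.univ : Finset (Finset (Fin 1))) = {∅, {0}} := by decide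
  refine ⟨{
    toFun := fun y S => if S = ∅ then ![y 0, y 1] else ![y 2, y 3]
    invFun := fun g => ![g ∅ 0, g ∅ 1, g {0} 0, g {0} 1]
    map_add' := fun x y => by
      ext S i; by_cases hS : S = ∅ <;> fin_cases i <;> simp [hS]
    map_smul' := fun t x => by
      ext S i; by_cases hS : S = ∅ <;> fin_cases i <;> simp [hS]
    left_inv := fun y => by ext i; fin_cases i <;> simp
    right_inv := fun g => by
      ext S i
      have hS : S = ∅ ∨ S = {0} := by simpa [hu] using Finset.mem_univ S
      rcases hS with rfl | rfl <;> fin_cases i <;> simp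
    map_app' := fun y => ?_ }⟩
  simp [pfisterQF, QuadraticMap.pi_apply, hu, binQF, quatNorm_apply, Matrix.toQuadraticMap',
    Matrix.toQuadraticForm', LinearMap.BilinMap.toQuadraticMap_apply,
    Matrix.toLinearMap₂'_apply, Fin.sum_univ_two]
  ring

lemma polar_apply_of_similar {V W : Type} [AddCommGroup V] [Module F V] [AddCommGroup W]
    [Module F W] {Q : QuadraticForm F V} {Q' : QuadraticForm F W} {T : V →ₗ[F] W} {a : F}
    (h : ∀ v, Q' (T v) = a * Q v) (v w : V) : polar Q' (T v) (T w) = a * polar Q v w := by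
  simp only [polar, ← map_add, h]
  ring

lemma exists_extend_similarity {K : Type} [Field K] (f : F →+* K)
    {T : (Fin n → F) →ₗ[F] (Fin m → F)} (hT : Function.Injective T)
    {Q : QuadraticForm F (Fin n → F)} {Q' : QuadraticForm F (Fin m → F)} {a : F}
    (h : ∀ v, Q' (T v) = a * Q v) :
    ∃ T' : (Fin n → K) →ₗ[K] (Fin m → K), Function.Injective T' ∧
      (∀ v : Fin n → F, T' (f ∘ v) = f ∘ T v) ∧
      ∀ v, extendQF F f Q' (T' v) = f a * extendQF F f Q v := by
  obtain ⟨S, hS⟩ := LinearMap.exists_leftInverse_of_injective T (LinearMap.ker_eq_bot.mpr hT)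
  have hmul : (LinearMap.toMatrix' S).map f * (LinearMap.toMatrix' T).map f = 1 := by
    rw [← Matrix.map_mul, ← LinearMap.toMatrix'_comp, hS, LinearMap.toMatrix'_id]
    exact Matrix.map_one f (map_zero f) (map_one f)
  refine ⟨((LinearMap.toMatrix' T).map f).mulVecLin, ?_, fun v => ?_, fun v => ?_⟩
  · refine Function.LeftInverse.injective (g := ((LinearMap.toMatrix' S).map f).mulVecLin)
      fun v => ?_
    simp only [Matrix.mulVecLin_apply, Matrix.mulVec_mulVec, hmul, Matrix.one_mulVec]
  · ext i
    rw [Matrix.mulVecLin_apply, ← RingHom.map_mulVec, LinearMap.toMatrix'_mulVec,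
      Function.comp_apply]
  · exact extendQF_mulVec f (fun v => by rw [LinearMap.toMatrix'_mulVec, h]) v

variable {c d : F}

lemma exists_polar_eq_zero (J : (Fin 3 → F) →ₗ[F] (Fin 4 → F)) :
    ∃ u ≠ 0, ∀ x, polar (quatNorm c d) u (J x) = 0 := by
  have hker := LinearMap.ker_ne_bot_of_finrank_lt
    (f := (LinearMap.lcomp F F J).comp (quatNorm c d).polarBilin) (by simp)
  obtain ⟨u, hu, hu0⟩ := Submodule.exists_mem_ne_zero_of_ne_bot hker
  exact ⟨u, hu0, fun x => LinearMap.congr_fun hu x⟩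

variable [CharP F 2] {K : Type} [Field K] (f : F →+* K)

lemma polar_quatNorm_map_eq_zero {J : (Fin 3 → F) →ₗ[F] (Fin 4 → F)} {u : Fin 4 → F}
    (hJu : ∀ x, polar (quatNorm c d) u (J x) = 0)
    {J' : (Fin 3 → K) →ₗ[K] (Fin 4 → K)} (hJ' : ∀ v : Fin 3 → F, J' (f ∘ v) = f ∘ J v)
    (x : Fin 3 → K) : polar (quatNorm (f c) (f d)) (f ∘ u) (J' x) = 0 := by
  have := charP_of_injective_ringHom f.injective 2
  have : ((quatNorm (f c) (f d)).polarBilin (f ∘ u)).comp J' = 0 := by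
    refine LinearMap.pi_ext' fun i => LinearMap.ext_ring ?_
    have hs : (Pi.single i 1 : Fin 3 → K) = f ∘ Pi.single i 1 := by
      ext j; simp [Pi.single_apply, apply_ite f]
    have h := congrArg f (hJu (Pi.single i 1))
    simp only [polar_quatNorm, map_add, map_mul, map_zero] at h
    simp [hs, hJ', polar_quatNorm, h]
  exact LinearMap.congr_fun this x

/-- Here `ψ` is similar to a quaternary norm form, and `ψ'` to its restriction to the hyperplane
orthogonal to `u`. -/
lemma not_anisotropic_of_funField_of_isotropic_subform
    {ψ : QuadraticForm F (Fin 4 → F)} {ψ' : QuadraticForm F (Fin 3 → F)}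
    {φ : QuadraticForm F (Fin n → F)} (hd : d ≠ 0)
    {T : (Fin 4 → F) →ₗ[F] (Fin 4 → F)} (hT : Function.Injective T) {a : F} (ha : a ≠ 0)
    (hTψ : ∀ v, quatNorm c d (T v) = a * ψ v)
    {J : (Fin 3 → F) →ₗ[F] (Fin 4 → F)} (hJ : Function.Injective J) {b : F}
    (hJψ : ∀ v, quatNorm c d (J v) = b * ψ' v) {u : Fin 4 → F}
    (hu : quatNorm c d u ≠ 0) (hJu : ∀ x, polar (quatNorm c d) u (J x) = 0)
    {e : Fin 3 → K} (he : e ≠ 0)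
    (he₀ : extendQF F f ψ' e = 0) (h : ¬ (extendQF F (funFieldMap F ψ) φ).Anisotropic) :
    ¬ (extendQF F f φ).Anisotropic := by
  have := charP_of_injective_ringHom f.injective 2
  have hd' : f d ≠ 0 := by simpa using hd
  have ha' : f a ≠ 0 := by simpa using ha
  obtain ⟨T', hT', -, hTψ'⟩ := exists_extend_similarity f hT hTψ
  obtain ⟨J', hJ', hJf, hJψ'⟩ := exists_extend_similarity f hJ hJψ
  rw [extendQF_quatNorm] at hTψ' hJψ'
  have hTs := LinearMap.injective_iff_surjective.mp hT'
  have hJu' := polar_quatNorm_map_eq_zero f hJu hJf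
  have hu' : quatNorm (f c) (f d) (f ∘ u) ≠ 0 := by
    rw [← extendQF_quatNorm, extendQF_map]; simpa using hu
  have hv : J' e ≠ 0 := fun h0 => he (hJ' (h0.trans J'.map_zero.symm))
  obtain ⟨x, hx⟩ := hTs (J' e)
  obtain ⟨r, hr⟩ := hTs (f ∘ u)
  have hpol := polar_apply_of_similar hTψ'
  refine not_anisotropic_of_funField f (Q := ψ) (e := x) (r := r) ?_ ?_ ?_ ?_ h
  · have := hTψ' x
    rw [hx, hJψ', he₀, mul_zero] at this
    exact (mul_eq_zero.mp this.symm).resolve_left ha'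
  · by_contra! h0
    refine hv (eq_zero_of_polar_quatNorm (c := f c) hd' fun w => ?_)
    obtain ⟨y, rfl⟩ := hTs w
    rw [← hx, hpol, h0, mul_zero]
  · have := hpol x r
    rw [hx, hr, polar_comm, hJu'] at this
    exact (mul_eq_zero.mp this.symm).resolve_left ha'
  · intro h0
    exact hu' (by rw [← hr, hTψ', h0, mul_zero])

lemma not_anisotropic_of_funField_subform_of_isotropic
    {ψ : QuadraticForm F (Fin 4 → F)} {ψ' : QuadraticForm F (Fin 3 → F)}
    {φ : QuadraticForm F (Fin n → F)} (hd : d ≠ 0)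
    {T : (Fin 4 → F) →ₗ[F] (Fin 4 → F)} (hT : Function.Injective T) {a : F}
    (hTψ : ∀ v, quatNorm c d (T v) = a * ψ v)
    {J : (Fin 3 → F) →ₗ[F] (Fin 4 → F)} (hJ : Function.Injective J) {b : F} (hb : b ≠ 0)
    (hJψ : ∀ v, quatNorm c d (J v) = b * ψ' v) {u : Fin 4 → F}
    (hu : quatNorm c d u ≠ 0) (hJu : ∀ x, polar (quatNorm c d) u (J x) = 0)
    {e : Fin 4 → K} (he : e ≠ 0)
    (he₀ : extendQF F f ψ e = 0) (h : ¬ (extendQF F (funFieldMap F ψ') φ).Anisotropic) :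
    ¬ (extendQF F f φ).Anisotropic := by
  have := charP_of_injective_ringHom f.injective 2
  have hd' : f d ≠ 0 := by simpa using hd
  have hb' : f b ≠ 0 := by simpa using hb
  obtain ⟨T', hT', -, hTψ'⟩ := exists_extend_similarity f hT hTψ
  obtain ⟨J', hJ', hJf, hJψ'⟩ := exists_extend_similarity f hJ hJψ
  rw [extendQF_quatNorm] at hTψ' hJψ'
  have hJu' := polar_quatNorm_map_eq_zero f hJu hJf
  have hu' : quatNorm (f c) (f d) (f ∘ u) ≠ 0 := by
    rw [← extendQF_quatNorm, extendQF_map]; simpa using hu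
  have hu₀ : f ∘ u ≠ 0 := fun h0 => hu' (by rw [h0, QuadraticMap.map_zero])
  have hpol := polar_apply_of_similar hJψ'
  obtain ⟨v, hv, hvu, hv₀⟩ := exists_isotropic_polar_eq_zero hd' hu'
    (fun h0 => he (hT' (h0.trans T'.map_zero.symm))) (by rw [hTψ', he₀, mul_zero])
  obtain ⟨x, rfl⟩ := exists_apply_eq_of_polar_eq_zero hd' hu₀ hJ' hJu' hvu
  obtain ⟨r, hr⟩ := exists_apply_eq_of_polar_eq_zero hd' hu₀ hJ' hJu' (w := f ∘ u) (by
    rw [polar_self, two_nsmul, CharTwo.add_self_eq_zero])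
  refine not_anisotropic_of_funField f (Q := ψ') (e := x) (r := r) ?_ ?_ ?_ ?_ h
  · rw [hJψ'] at hv₀
    exact (mul_eq_zero.mp hv₀).resolve_left hb'
  · by_contra! h0
    refine hv (eq_zero_of_polar_quatNorm_apply hd' hu' hJ' hJu' (fun y => ?_) hv₀)
    rw [hpol, h0, mul_zero]
  · have := hpol x r
    rw [hr, polar_comm, hvu] at this
    exact (mul_eq_zero.mp this.symm).resolve_left hb'
  · intro h0
    exact hu' (by rw [← hr, hJψ', h0, mul_zero])

end Transfer

theorem stmt6 (F : Type) [Field F] [CharP F 2]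
    (φ : QuadraticForm F (Fin 5 → F)) (hφa : φ.Anisotropic) (hφt : HasTypeRS φ 1 3)
    (hφpn : ¬ IsPfisterNeighbour φ)
    (ψ : QuadraticForm F (Fin 4 → F)) (hψa : ψ.Anisotropic) (hψt : HasTypeRS ψ 2 0)
    (harf : ∃ a b : Fin 2 → F, ψ.Equivalent (binsQF a b) ∧
      (∑ i, a i * b i) ∈ ArtinSchreier F)
    (d : Fˣ) (cπ : F) (γ : Fˣ)
    (hsim : ψ.Equivalent ((γ : F) • pfisterQF 1 (fun _ => (d : F)) cπ))
    (ψ' : QuadraticForm F (Fin 3 → F)) (hψ'a : ψ'.Anisotropic)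
    (hψ'w : WeaklyDominated ψ' (pfisterQF 1 (fun _ => (d : F)) cπ)) :
    (¬ (extendQF F (funFieldMap F ψ) φ).Anisotropic ↔
      ¬ (extendQF F (funFieldMap F ψ') φ).Anisotropic) := by
  obtain ⟨p⟩ := quatNorm_equivalent_pfisterQF cπ (d : F)
  obtain ⟨g⟩ := hsim.trans
    (⟨p.symm.toLinearEquiv, fun x => by simp⟩ :
      QuadraticMap.Equivalent ((γ : F) • pfisterQF 1 (fun _ => (d : F)) cπ)
        ((γ : F) • quatNorm cπ (d : F)))
  obtain ⟨α, J₀, hJ₀, hJψ₀⟩ := hψ'w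
  have hTψ : ∀ v, quatNorm cπ (d : F) (g.toLinearEquiv.toLinearMap v) = (γ : F)⁻¹ * ψ v := by
    intro v
    rw [eq_inv_mul_iff_mul_eq₀ γ.ne_zero]
    exact g.map_app v
  have hT : Function.Injective g.toLinearEquiv.toLinearMap := g.toLinearEquiv.injective
  have hJψ : ∀ v, quatNorm cπ (d : F) ((p.symm.toLinearEquiv.toLinearMap ∘ₗ J₀) v)
      = (α : F) * ψ' v := fun v => (p.symm.map_app (J₀ v)).trans (hJψ₀ v).symm
  have hJ : Function.Injective (p.symm.toLinearEquiv.toLinearMap ∘ₗ J₀) :=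
    p.symm.toLinearEquiv.injective.comp hJ₀
  obtain ⟨u, hu₀, hJu⟩ := exists_polar_eq_zero (c := cπ) (d := (d : F))
    (p.symm.toLinearEquiv.toLinearMap ∘ₗ J₀)
  have hu : quatNorm cπ (d : F) u ≠ 0 := by
    obtain ⟨y, rfl⟩ := g.toLinearEquiv.surjective u
    intro h0
    have : ψ y = 0 := by
      have := hTψ y
      rw [show quatNorm cπ (d : F) (g.toLinearEquiv.toLinearMap y) = 0 from h0] at this
      simpa using this.symm
    exact hu₀ (by rw [hψa y this, map_zero])
  constructor
  · obtain ⟨e, he, he₀⟩ := exists_isotropic_funField hψ'a (by norm_num)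
    exact @not_anisotropic_of_funField_of_isotropic_subform F _ _ cπ d _ (FunField F ψ')
      (isField_funField hψ'a (by norm_num)).toField (funFieldMap F ψ') ψ ψ' φ d.ne_zero _ hT _
      (inv_ne_zero γ.ne_zero) hTψ _ hJ _ hJψ u hu hJu e he he₀
  · obtain ⟨e, he, he₀⟩ := exists_isotropic_funField hψa (by norm_num)
    exact @not_anisotropic_of_funField_subform_of_isotropic F _ _ cπ d _ (FunField F ψ)
      (isField_funField hψa (by norm_num)).toField (funFieldMap F ψ) ψ ψ' φ d.ne_zero _ hT _
      hTψ _ hJ _ α.ne_zero hJψ u hu hJu e he he₀
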